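/- For every positive integer n, σ₁₁(n) ≡ τ(n) (mod 691), where σ₁₁(n) is the sum of the 11th powers of the positive divisors of n and τ is the Ramanujan tau function. -/

import Mathlib

/-- Ramanujan's tau function, defined as the `n`-th coefficient of
`q * ∏_{k=1}^{n} (1 - q^k)^24` (the truncated product determines
the coefficient since higher factors do not contribute in degree `n`). -/
noncomputable def ramanujanTau (n : ℕ) : ℤ :=
  ((Polynomial.X : Polynomial ℤ) *
    ∏ k ∈ Finset.Icc 1 n, ((1 : Polynomial ℤ) - Polynomial.X ^ k) ^ 24).coeff n

open UpperHalfPlane ModularForm ModularFormClass MatrixGroups EisensteinSeries Filter Topology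

lemma tlu_pow {ι : Type*} {F : ι → ℂ → ℂ} {f : ℂ → ℂ} {p : Filter ι} {U : Set ℂ}
    (h : TendstoLocallyUniformlyOn F f p U) (hf : ContinuousOn f U) (k : ℕ) :
    TendstoLocallyUniformlyOn (fun i z => F i z ^ k) (fun z => f z ^ k) p U := by
  induction k with
  | zero =>
    simp only [pow_zero]
    intro u hu x hx
    exact ⟨U, self_mem_nhdsWithin, .of_forall fun _ _ _ => refl_mem_uniformity hu⟩
  | succ k ih =>
    simp only [pow_succ]
    exact ih.mul₀ h (hf.pow k) hf

lemma tlu_iter {F : ℕ → ℂ → ℂ} {f : ℂ → ℂ} {U : Set ℂ} (hU : IsOpen U)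
    (h : TendstoLocallyUniformlyOn F f atTop U) (hF : ∀ n, Differentiable ℂ (F n)) (k : ℕ) :
    TendstoLocallyUniformlyOn (fun n => iteratedDeriv k (F n)) (iteratedDeriv k f) atTop U := by
  induction k with
  | zero => simpa using h
  | succ k ih =>
    simp only [iteratedDeriv_succ]
    refine ih.deriv (.of_forall fun n => ?_) hU
    exact ((hF n).contDiff (n := k+1) |>.differentiable_iteratedDeriv' k).differentiableOn

lemma iter_poly (P : Polynomial ℤ) (k : ℕ) :
    iteratedDeriv k (fun z : ℂ => Polynomial.aeval z P) 0 = k.factorial * (P.coeff k : ℂ) := by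
  have : ∀ (k : ℕ), iteratedDeriv k (fun z : ℂ => Polynomial.aeval z P)
      = fun z : ℂ => Polynomial.aeval z (Polynomial.derivative^[k] P) := by
    intro k
    induction k with
    | zero => simp
    | succ k ih =>
      rw [iteratedDeriv_succ, ih, Function.iterate_succ_apply']
      ext z
      exact Polynomial.deriv_aeval _
  rw [this]
  simp only
  rw [Polynomial.aeval_def, Polynomial.eval₂_at_zero, Polynomial.coeff_iterate_derivative]
  simp [Nat.descFactorial_self]

noncomputable def tauPoly (N : ℕ) : Polynomial ℤ :=
  Polynomial.X * ∏ k ∈ Finset.Icc 1 N, ((1 : Polynomial ℤ) - Polynomial.X ^ k) ^ 24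

lemma tauPoly_coeff (n N : ℕ) (h : n ≤ N) : (tauPoly N).coeff n = ramanujanTau n := by
  induction N, h using Nat.le_induction with
  | base => rfl
  | succ N hN ih =>
    rw [← ih]
    have h1 : tauPoly (N+1) = tauPoly N * (1 - Polynomial.X ^ (N+1))^24 := by
      simp only [tauPoly]
      rw [Finset.prod_Icc_succ_top (by omega)]; ring
    have h2 : (Polynomial.X : Polynomial ℤ) ^ (N+1) ∣ tauPoly (N+1) - tauPoly N := by
      have : (Polynomial.X : Polynomial ℤ) ^ (N+1) ∣ (1 - Polynomial.X ^ (N+1))^24 - 1^24 := by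
        refine dvd_trans ?_ (sub_dvd_pow_sub_pow _ _ 24)
        exact ⟨-1, by ring⟩
      rw [h1, show tauPoly N * (1 - Polynomial.X ^ (N+1))^24 - tauPoly N
        = tauPoly N * ((1 - Polynomial.X ^ (N+1))^24 - 1^24) by ring]
      exact this.mul_left _
    have := Polynomial.X_pow_dvd_iff.mp h2 n (by omega)
    rw [Polynomial.coeff_sub] at this
    omega

lemma disc_coeff (n : ℕ) : (qExpansion 1 discriminant).coeff n = (ramanujanTau n : ℂ) := by
  rw [qExpansion_coeff]
  have hU : IsOpen (Metric.ball (0:ℂ) 1) := Metric.isOpen_ball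
  have h0 : (0:ℂ) ∈ Metric.ball (0:ℂ) 1 := Metric.mem_ball_self one_pos
  have hbase : TendstoLocallyUniformlyOn (fun (N : ℕ) (z : ℂ) => ∏ i ∈ Finset.range N, (1 - z ^ (i+1)))
      (fun z => ∏' i, (1 - z ^ (i+1))) atTop (Metric.ball (0:ℂ) 1) := by
    have := multipliableLocallyUniformlyOn_one_sub_pow.hasProdLocallyUniformlyOn.tendstoLocallyUniformlyOn_finsetRange
    simpa using! this
  have h24 := tlu_pow hbase differentiableOn_tprod_one_sub_pow.continuousOn 24
  have hid : TendstoLocallyUniformlyOn (fun (_ : ℕ) (z : ℂ) => z) (fun z => z) atTop (Metric.ball (0:ℂ) 1) := by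
    intro u hu x hx
    exact ⟨_, self_mem_nhdsWithin, .of_forall fun _ _ _ => refl_mem_uniformity hu⟩
  have hm := hid.mul₀ h24 continuousOn_id (differentiableOn_tprod_one_sub_pow.continuousOn.pow 24)
  have hF : (fun (_ : ℕ) (z : ℂ) => z) * (fun (N : ℕ) (z : ℂ) => (∏ i ∈ Finset.range N, (1 - z ^ (i+1)))^24)
      = fun N z => Polynomial.aeval z (tauPoly N) := by
    ext N z
    have e : ∏ i ∈ Finset.range N, (1 - z ^ (i+1)) = ∏ i ∈ Finset.Icc 1 N, (1 - z ^ i) := by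
      rw [Finset.range_eq_Ico, Finset.prod_Ico_add' (fun i => (1 - z ^ i)) 0 N 1]
      rfl
    simp only [tauPoly, Pi.mul_apply, Finset.prod_pow, map_mul, map_pow, map_prod, map_sub,
      map_one, Polynomial.aeval_X, e]
  have hc : TendstoLocallyUniformlyOn (fun (N : ℕ) (z : ℂ) => Polynomial.aeval z (tauPoly N))
      (cuspFunction 1 discriminant) atTop (Metric.ball (0:ℂ) 1) := by
    rw [← hF]
    refine hm.congr_right fun z hz => ?_
    rw [discriminant_cuspFunction_eqOn hz]
    simp only [Pi.mul_apply]
    rw [(multipliable_one_sub_pow (by simpa using hz)).tprod_pow]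
  have := (tlu_iter hU hc (fun N => Polynomial.differentiable_aeval _) n).tendsto_at h0
  simp only [iter_poly] at this
  have h2 : Tendsto (fun N => (n.factorial : ℂ) * ((tauPoly N).coeff n : ℂ)) atTop
      (𝓝 ((n.factorial : ℂ) * (ramanujanTau n : ℂ))) := by
    refine tendsto_const_nhds.congr' ?_
    filter_upwards [eventually_ge_atTop n] with N hN
    rw [tauPoly_coeff n N hN]
  rw [tendsto_nhds_unique this h2]
  field_simp [Nat.factorial_ne_zero]

lemma tau_one : ramanujanTau 1 = 1 := by
  have := disc_coeff 1
  rw [discriminant_qExpansion_coeff_one] at this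
  exact_mod_cast this.symm

noncomputable def e6 : PowerSeries ℤ := .mk fun m => if m = 0 then 1 else -504 * (ArithmeticFunction.sigma 5 m : ℤ)

lemma E6_eq : qExpansion 1 E₆ = e6.map (Int.castRingHom ℂ) := by
  ext m
  rw [E_qExpansion_coeff _ ⟨3, rfl⟩]
  simp only [e6, PowerSeries.coeff_map, PowerSeries.coeff_mk]
  split_ifs
  · simp
  · norm_num [show bernoulli 6 = 1 / 42 by decide +kernel]

noncomputable def FF : ModularForm 𝒮ℒ 12 :=
  E (k := 12) (by norm_num) - ModularForm.mcast (by decide) (E₆.pow 2)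

lemma FF_q : qExpansion 1 FF = qExpansion 1 (E (k := 12) (by norm_num)) - qExpansion 1 E₆ ^ 2 := by
  simp only [FF, FunLike.coe_sub, coe_mcast,
    ModularForm.qExpansion_sub one_pos one_mem_strictPeriods_SL,
    ModularForm.qExpansion_pow one_pos one_mem_strictPeriods_SL]

lemma E12_coeff (m : ℕ) (hm : m ≠ 0) : (qExpansion 1 (E (k := 12) (by norm_num))).coeff m
    = 65520 / 691 * (ArithmeticFunction.sigma 11 m : ℂ) := by
  rw [E_qExpansion_coeff _ ⟨6, rfl⟩, if_neg hm]
  norm_num [show bernoulli 12 = -691 / 2730 by decide +kernel]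

lemma FF_coeff (m : ℕ) (hm : m ≠ 0) : (qExpansion 1 FF).coeff m =
    65520 / 691 * (ArithmeticFunction.sigma 11 m : ℂ) - (((e6^2).coeff m : ℤ) : ℂ) := by
  rw [FF_q, map_sub, E12_coeff m hm, E6_eq, ← map_pow, PowerSeries.coeff_map]
  rfl

lemma FF_cusp : IsCuspForm FF := by
  rw [isCuspForm_iff_coeffZero_eq_zero, FF_q, map_sub, E_qExpansion_coeff_zero _ ⟨6, rfl⟩, E6_eq, ← map_pow,
    PowerSeries.coeff_map]
  simp [e6, ← PowerSeries.coeff_zero_eq_constantCoeff_apply, pow_two, PowerSeries.coeff_mul,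
    -PowerSeries.coeff_zero_eq_constantCoeff]

lemma e6_one : (e6^2).coeff 1 = -1008 := by
  simp [pow_two, PowerSeries.coeff_mul, Finset.Nat.antidiagonal_succ, e6]

lemma key (n : ℕ) (hn : n ≠ 0) :
    65520 * (ArithmeticFunction.sigma 11 n : ℤ) - 691 * (e6^2).coeff n
      = (65520 + 691 * 1008) * ramanujanTau n := by
  obtain ⟨g, hg⟩ := FF_cusp
  obtain ⟨c, hc⟩ := CuspForm.exists_smul_discriminant_of_weight_eq_twelve g
  have hgE : (g : ℍ → ℂ) = FF := congrArg DFunLike.coe hg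
  have hcΔ : (c • CuspForm.discriminant : ℍ → ℂ) = g := congrArg DFunLike.coe hc
  have hgΔ := ModularForm.qExpansion_smul one_pos one_mem_strictPeriods_SL c
      CuspForm.discriminant
  rw [hcΔ, hgE] at hgΔ
  have h : ∀ m, (qExpansion 1 FF).coeff m = c * (ramanujanTau m : ℂ) := fun m => by
    rw [hgΔ, PowerSeries.coeff_smul, smul_eq_mul, ← disc_coeff]; rfl
  have h1 := h 1
  rw [FF_coeff 1 one_ne_zero, e6_one, tau_one] at h1
  have h2 := h n
  rw [FF_coeff n hn] at h2
  simp at h1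
  have : (65520 * (ArithmeticFunction.sigma 11 n : ℂ) - 691 * ((e6^2).coeff n : ℤ) : ℂ)
      = (65520 + 691 * 1008) * ramanujanTau n := by
    rw [← h1] at h2
    linear_combination 691 * h2
  exact_mod_cast this

theorem ramanujan_congruence (n : ℕ) (hn : 0 < n) :
    ((ArithmeticFunction.sigma 11 n : ℕ) : ℤ) ≡ ramanujanTau n [ZMOD 691] := by
  have := key n hn.ne'
  rw [Int.ModEq]
  omega
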